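/- arXiv:2505.06925 — 2 statements merged into one kernel-verified Lean document; each statement's English description precedes it below -/
import Mathlib

section
/- Let A ∈ B(H,K) be compact and nonzero, W a subspace of B(H,K), and ε ∈ [0,1). Then A is ε-Birkhoff orthogonal to W if and only if there exists a positive finite-rank trace-class operator P on H with tr(P) = 1 and A*AP = ‖A‖²P such that |tr(A*XP)| ≤ ε‖A‖‖X‖ for all X ∈ W. -/
open ContinuousLinearMap Filter Set

/-- The trace of a finite-rank operator: the trace of the induced endomorphism of its
(finite-dimensional) range. -/
noncomputable def finRankTrace {H : Type*} [NormedAddCommGroup H]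
    [InnerProductSpace ℂ H] (T : H →L[ℂ] H) : ℂ :=
  LinearMap.trace ℂ (LinearMap.range (T : H →ₗ[ℂ] H))
    ((T : H →ₗ[ℂ] H).restrict (p := LinearMap.range (T : H →ₗ[ℂ] H))
      (q := LinearMap.range (T : H →ₗ[ℂ] H))
      (fun x _ => LinearMap.mem_range_self _ x))

section

variable {H K : Type*} [NormedAddCommGroup H] [InnerProductSpace ℂ H]
  [NormedAddCommGroup K] [InnerProductSpace ℂ K]

lemma finRankTrace_eq_sum_inner {ι : Type*} [Fintype ι] (T : H →L[ℂ] H)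
    (hT : FiniteDimensional ℂ (LinearMap.range (T : H →ₗ[ℂ] H)))
    (E : Submodule ℂ H) [FiniteDimensional ℂ E] (hE : ∀ x ∈ Eᗮ, T x = 0)
    (b : OrthonormalBasis ι ℂ E) :
    finRankTrace T = ∑ i, inner ℂ (b i : H) (T (b i)) := by
  have hproj : ∀ x, T (E.orthogonalProjectionOnto x) = T x := fun x => by
    have := hE _ (E.sub_starProjection_mem_orthogonal x)
    rw [map_sub, sub_eq_zero] at this
    exact this.symm
  let R := LinearMap.range (T : H →ₗ[ℂ] H)
  let f : E →ₗ[ℂ] R := (T : H →ₗ[ℂ] H).rangeRestrict ∘ₗ E.subtype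
  let g : R →ₗ[ℂ] E := (E.orthogonalProjectionOnto : H →ₗ[ℂ] E) ∘ₗ R.subtype
  have h : finRankTrace T = LinearMap.trace ℂ R (f ∘ₗ g) := by
    unfold finRankTrace
    congr 1
    ext x
    exact (hproj x).symm
  rw [h, LinearMap.trace_comp_comm', LinearMap.trace_eq_sum_inner _ b]
  refine Finset.sum_congr rfl fun i _ => ?_
  simp [f, g]

lemma ContinuousLinearMap.exists_norm_le_one_sq_sub_le (T : H →L[ℂ] K) {δ : ℝ} (hδ : 0 < δ) :
    ∃ u, ‖u‖ ≤ 1 ∧ ‖T‖ ^ 2 - δ ≤ ‖T u‖ ^ 2 := by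
  rcases lt_or_ge (‖T‖ ^ 2) δ with h | h
  · exact ⟨0, by simp, by simp; linarith⟩
  · obtain ⟨u, hu, hr⟩ := T.exists_lt_apply_of_lt_opNorm (r := √(‖T‖ ^ 2 - δ))
      ((Real.sqrt_lt' (by by_contra! h0; nlinarith [norm_nonneg T])).2 (by linarith))
    exact ⟨u, hu.le, (Real.sqrt_le_left (norm_nonneg _)).1 hr.le⟩

lemma norm_add_ofReal_smul_sq (x y : K) (t : ℝ) :
    ‖x + (t : ℂ) • y‖ ^ 2 = ‖x‖ ^ 2 + 2 * t * (inner ℂ x y).re + t ^ 2 * ‖y‖ ^ 2 := by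
  have := @norm_add_sq ℂ K _ _ _ x ((t : ℂ) • y)
  rw [this, inner_smul_right, norm_smul, mul_pow]
  simp
  ring

/-- A positive operator on `H` of trace one with range in `E`, where the trace is computed in an
orthonormal basis of `E`. -/
def densityOperatorsOn {ι : Type*} [Fintype ι] (E : Submodule ℂ H) (b : OrthonormalBasis ι ℂ E) :
    Set (H →L[ℂ] H) :=
  {P | P.IsPositive ∧ (∀ x, P x ∈ E) ∧ ∑ i, inner ℂ (b i : H) (P (b i)) = 1}

lemma convex_densityOperatorsOn {ι : Type*} [Fintype ι] (E : Submodule ℂ H)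
    (b : OrthonormalBasis ι ℂ E) : Convex ℝ (densityOperatorsOn E b) := by
  rintro P ⟨hP, hPE, hPt⟩ Q ⟨hQ, hQE, hQt⟩ s t hs ht hst
  refine ⟨?_, fun x => ?_, ?_⟩
  · rw [← Complex.coe_smul s P, ← Complex.coe_smul t Q]
    exact (hP.smul_of_nonneg (by exact_mod_cast hs)).add
      (hQ.smul_of_nonneg (by exact_mod_cast ht))
  · exact E.add_mem (E.smul_of_tower_mem s (hPE x)) (E.smul_of_tower_mem t (hQE x))
  · have : ∀ i, inner ℂ (b i : H) ((s • P + t • Q) (b i)) =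
        s * inner ℂ (b i : H) (P (b i)) + t * inner ℂ (b i : H) (Q (b i)) := fun i => by
      simp [inner_smul_right_eq_smul]
    simp only [this, Finset.sum_add_distrib, ← Finset.mul_sum, hPt, hQt]
    rw [mul_one, mul_one]
    exact_mod_cast hst

lemma isClosed_densityOperatorsOn {ι : Type*} [Fintype ι] (E : Submodule ℂ H)
    [FiniteDimensional ℂ E] (b : OrthonormalBasis ι ℂ E) :
    IsClosed (densityOperatorsOn E b) := by
  have hpos : IsClosed {P : H →L[ℂ] H | P.IsPositive} := by
    have : {P : H →L[ℂ] H | P.IsPositive} = {P | ∀ x y, inner ℂ (P x) y = inner ℂ x (P y)} ∩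
        {P | ∀ x, 0 ≤ (inner ℂ (P x) x).re} := rfl
    rw [this]
    refine IsClosed.inter ?_ ?_
    · rw [ofPred_forall]
      refine isClosed_iInter fun x => ?_
      rw [ofPred_forall]
      exact isClosed_iInter fun y => isClosed_eq (by fun_prop) (by fun_prop)
    · rw [ofPred_forall]
      exact isClosed_iInter fun x => isClosed_le continuous_const (by fun_prop)
  refine hpos.inter (IsClosed.inter ?_ ?_)
  · change IsClosed {P : H →L[ℂ] H | ∀ x, P x ∈ E}
    rw [ofPred_forall]
    exact isClosed_iInter fun x => E.closed_of_finiteDimensional.preimage (by fun_prop)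
  · exact isClosed_eq (by fun_prop) continuous_const

lemma sum_inner_rankOne_self {ι : Type*} [Fintype ι] (E : Submodule ℂ H)
    (b : OrthonormalBasis ι ℂ E) (A X : H →L[ℂ] K) (u : E) :
    ∑ i, inner ℂ (A (b i)) (X (InnerProductSpace.rankOne ℂ (u : H) (u : H) (b i))) =
      inner ℂ (A u) (X u) := by
  have h : ∑ i, inner ℂ (b i) u • (b i : H) = u := by
    simpa using congrArg Subtype.val (b.sum_repr' u)
  conv_rhs => rw [← congrArg A h]
  simp [mul_comm]

variable [CompleteSpace H] [CompleteSpace K]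

lemma norm_adjoint_apply_sub_sq_le (A : H →L[ℂ] K) {u : H} (hu : ‖u‖ ≤ 1) :
    ‖adjoint A (A u) - ((‖A‖ ^ 2 : ℝ) : ℂ) • u‖ ^ 2 ≤
      2 * ‖A‖ ^ 2 * (‖A‖ ^ 2 - ‖A u‖ ^ 2) := by
  have h := norm_add_ofReal_smul_sq (adjoint A (A u)) u (-(‖A‖ ^ 2))
  rw [adjoint_inner_left] at h
  have h1 : (inner ℂ (A u) (A u)).re = ‖A u‖ ^ 2 := by
    rw [inner_self_eq_norm_sq_to_K]; norm_cast
  have h2 : ‖adjoint A (A u)‖ ≤ ‖A‖ * ‖A u‖ := by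
    simpa using (adjoint A).le_opNorm (A u)
  have h3 : ‖A u‖ ≤ ‖A‖ := A.unit_le_opNorm u hu
  have h4 : ‖adjoint A (A u)‖ ^ 2 ≤ ‖A‖ ^ 2 * ‖A‖ ^ 2 := by
    rw [← mul_pow]; gcongr; exact h2.trans (by gcongr)
  have h5 : ‖u‖ ^ 2 ≤ 1 := pow_le_one₀ (norm_nonneg _) hu
  have h6 : (‖A‖ ^ 2) ^ 2 * ‖u‖ ^ 2 ≤ (‖A‖ ^ 2) ^ 2 * 1 := by gcongr
  rw [h1] at h
  rw [sub_eq_add_neg, ← neg_smul, ← Complex.ofReal_neg, h]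
  nlinarith

lemma IsCompactOperator.exists_norm_attaining_le_re_inner {A : H →L[ℂ] K} (hA : A ≠ 0)
    (hcpt : IsCompactOperator A) (X : H →L[ℂ] K) (c : ℝ)
    (h : ∀ t : ℝ, 0 < t → ‖A‖ ^ 2 + 2 * t * c ≤ ‖A + (t : ℂ) • X‖ ^ 2) :
    ∃ u : H, ‖u‖ = 1 ∧ adjoint A (A u) = ((‖A‖ ^ 2 : ℝ) : ℂ) • u ∧
      c ≤ (inner ℂ (A u) (X u)).re := by
  have hA0 : 0 < ‖A‖ := norm_pos_iff.2 hA
  let t : ℕ → ℝ := fun n => 1 / ((n : ℝ) + 1)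
  have ht : ∀ n, 0 < t n := fun n => by positivity
  have htl : Tendsto t atTop (nhds 0) := tendsto_one_div_add_atTop_nhds_zero_nat
  choose u hu1 hu2 using fun n =>
    (A + (t n : ℂ) • X).exists_norm_le_one_sq_sub_le (sq_pos_of_pos (ht n))
  have hAu : ∀ n, ‖A (u n)‖ ≤ ‖A‖ := fun n => A.unit_le_opNorm _ (hu1 n)
  have hXu : ∀ n, ‖X (u n)‖ ≤ ‖X‖ := fun n => X.unit_le_opNorm _ (hu1 n)
  have key : ∀ n, ‖A‖ ^ 2 + 2 * t n * c - t n ^ 2 ≤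
      ‖A (u n)‖ ^ 2 + 2 * t n * (inner ℂ (A (u n)) (X (u n))).re + t n ^ 2 * ‖X‖ ^ 2 := by
    intro n
    have h1 := hu2 n
    have h2 := h _ (ht n)
    rw [add_apply, smul_apply, norm_add_ofReal_smul_sq] at h1
    have h3 : t n ^ 2 * ‖X (u n)‖ ^ 2 ≤ t n ^ 2 * ‖X‖ ^ 2 := by gcongr; exact hXu n
    linarith
  have hre : ∀ n, c - t n * (1 + ‖X‖ ^ 2) / 2 ≤ (inner ℂ (A (u n)) (X (u n))).re := by
    intro n
    have h1 : ‖A (u n)‖ ^ 2 ≤ ‖A‖ ^ 2 := by gcongr; exact hAu n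
    have h2 := key n
    have h3 := ht n
    by_contra! h4
    nlinarith [mul_lt_mul_of_pos_left h4 h3]
  have hnorm : ∀ n, ‖A‖ ^ 2 + t n * (2 * c - t n - t n * ‖X‖ ^ 2 - 2 * (‖A‖ * ‖X‖)) ≤
      ‖A (u n)‖ ^ 2 := by
    intro n
    have h1 : (inner ℂ (A (u n)) (X (u n))).re ≤ ‖A‖ * ‖X‖ :=
      (Complex.re_le_norm _).trans ((norm_inner_le_norm _ _).trans
        (mul_le_mul (hAu n) (hXu n) (norm_nonneg _) hA0.le))
    nlinarith [key n, mul_le_mul_of_nonneg_left h1 (ht n).le]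
  obtain ⟨S, hS, hSA⟩ :=
    IsCompactOperator.image_closedBall_subset_compact (f := (A : H →ₗ[ℂ] K)) hcpt 1
  obtain ⟨v, -, φ, hφ, hv⟩ := hS.tendsto_subseq (x := fun n => A (u n))
    fun n => hSA ⟨u n, by simpa using hu1 n, rfl⟩
  have htφ : Tendsto (t ∘ φ) atTop (nhds 0) := htl.comp hφ.tendsto_atTop
  have hvn : ‖A‖ ^ 2 ≤ ‖v‖ ^ 2 := by
    have hl : Tendsto (fun n => ‖A‖ ^ 2 + (t ∘ φ) n * (2 * c - (t ∘ φ) n - (t ∘ φ) n * ‖X‖ ^ 2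
        - 2 * (‖A‖ * ‖X‖))) atTop
        (nhds (‖A‖ ^ 2 + 0 * (2 * c - 0 - 0 * ‖X‖ ^ 2 - 2 * (‖A‖ * ‖X‖)))) :=
      (htφ.mul (((htφ.const_sub _).sub (htφ.mul_const _)).sub_const _)).const_add _
    rw [zero_mul, add_zero] at hl
    exact le_of_tendsto_of_tendsto' hl (hv.norm.pow 2) fun n => hnorm (φ n)
  have hdiff : Tendsto (fun n => adjoint A (A (u (φ n))) - ((‖A‖ ^ 2 : ℝ) : ℂ) • u (φ n))
      atTop (nhds 0) := by
    have hl : Tendsto (fun n => √(2 * ‖A‖ ^ 2 * (‖A‖ ^ 2 - ‖A (u (φ n))‖ ^ 2))) atTop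
        (nhds √(2 * ‖A‖ ^ 2 * (‖A‖ ^ 2 - ‖v‖ ^ 2))) :=
      (((hv.norm.pow 2).const_sub _).const_mul _).sqrt
    have hv0 : 2 * ‖A‖ ^ 2 * (‖A‖ ^ 2 - ‖v‖ ^ 2) ≤ 0 :=
      mul_nonpos_of_nonneg_of_nonpos (by positivity) (by linarith)
    rw [Real.sqrt_eq_zero_of_nonpos hv0] at hl
    exact squeeze_zero_norm
      (fun n => Real.le_sqrt_of_sq_le (norm_adjoint_apply_sub_sq_le A (hu1 (φ n)))) hl
  have hm : ((‖A‖ ^ 2 : ℝ) : ℂ) ≠ 0 := by exact_mod_cast (pow_pos hA0 2).ne'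
  obtain ⟨w, hw⟩ : ∃ w, Tendsto (fun n => u (φ n)) atTop (nhds w) := by
    refine ⟨_, ((((adjoint A).continuous.tendsto v).comp hv |>.sub hdiff).const_smul
      ((‖A‖ ^ 2 : ℝ) : ℂ)⁻¹).congr fun n => ?_⟩
    simp only [Function.comp_apply, sub_sub_cancel]
    exact inv_smul_smul₀ hm _
  have hAw : A w = v := tendsto_nhds_unique ((A.continuous.tendsto w).comp hw) hv
  have hw1 : ‖w‖ ≤ 1 := le_of_tendsto' hw.norm fun n => hu1 (φ n)
  refine ⟨w, le_antisymm hw1 ?_, ?_, ?_⟩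
  · have h1 : ‖A‖ ≤ ‖A w‖ := by
      rw [hAw]; exact le_of_sq_le_sq hvn (norm_nonneg _)
    have h2 := h1.trans (A.le_opNorm w)
    exact (le_mul_iff_one_le_right hA0).1 h2
  · have h1 := norm_adjoint_apply_sub_sq_le A hw1
    rw [hAw] at h1 ⊢
    have h2 : ‖adjoint A v - ((‖A‖ ^ 2 : ℝ) : ℂ) • w‖ ^ 2 ≤ 0 := by nlinarith [sq_nonneg ‖A‖]
    rw [← sub_eq_zero, ← norm_eq_zero]
    exact pow_eq_zero_iff two_ne_zero |>.1 (le_antisymm h2 (sq_nonneg _))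
  · have hl : Tendsto (fun n => c - (t ∘ φ) n * (1 + ‖X‖ ^ 2) / 2) atTop
        (nhds (c - 0 * (1 + ‖X‖ ^ 2) / 2)) :=
      ((htφ.mul_const _).div_const _).const_sub _
    rw [zero_mul, zero_div, sub_zero] at hl
    have hr : Tendsto (fun n => (inner ℂ (A (u (φ n))) (X (u (φ n)))).re) atTop
        (nhds (inner ℂ (A w) (X w)).re) :=
      (Complex.continuous_re.tendsto _).comp
        (((A.continuous.tendsto w).comp hw).inner ((X.continuous.tendsto w).comp hw))
    exact le_of_tendsto_of_tendsto' hl hr fun n => hre (φ n)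

lemma exists_density_forall_nonneg {ι : Type*} [Fintype ι] (A : H →L[ℂ] K)
    (W : Submodule ℂ (H →L[ℂ] K)) {c : ℝ} (hc : 0 ≤ c)
    (E : Submodule ℂ H) [FiniteDimensional ℂ E] (b : OrthonormalBasis ι ℂ E)
    (h : ∀ X ∈ W, ∃ u ∈ E, ‖u‖ = 1 ∧ -(c * ‖X‖) ≤ (inner ℂ (A u) (X u)).re) :
    ∃ P ∈ densityOperatorsOn E b, ∀ X ∈ W,
      -(c * ‖X‖) ≤ (∑ i, inner ℂ (A (b i)) (X (P (b i)))).re := by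
  let S : Set (H →L[ℂ] H) := (fun u : E => InnerProductSpace.rankOne ℂ (u : H) (u : H)) ''
    Metric.sphere (0 : E) 1
  have hScpt : IsCompact S :=
    haveI := FiniteDimensional.proper ℂ E
    (isCompact_sphere _ _).image (by
      change Continuous fun u : E => smulRightL ℂ H H (innerSL ℂ (u : H)) (u : H)
      fun_prop)
  let C := closedConvexHull ℝ S
  have hCcpt : IsCompact C := by
    rw [show C = _ from closedConvexHull_eq_closure_convexHull]
    exact hScpt.totallyBounded.convexHull.closure.isCompact_of_isClosed isClosed_closure
  have hSD : S ⊆ densityOperatorsOn E b := by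
    rintro _ ⟨u, hu, rfl⟩
    refine ⟨InnerProductSpace.isPositive_rankOne_self _, fun x => ?_, ?_⟩
    · exact E.smul_mem _ u.2
    · have := sum_inner_rankOne_self E b (.id ℂ H) (.id ℂ H) u
      simp only [ContinuousLinearMap.id_apply] at this
      have hu1 : ‖(u : H)‖ = 1 := by simpa using hu
      rw [this, inner_self_eq_norm_sq_to_K, hu1]
      simp
  have hCD : C ⊆ densityOperatorsOn E b :=
    closedConvexHull_min hSD (convex_densityOperatorsOn E b) (isClosed_densityOperatorsOn E b)
  let f : (H →L[ℂ] H) → (H →L[ℂ] K) → ℝ := fun P X =>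
    -(∑ i, inner ℂ (A (b i)) (X (P (b i)))).re - c * ‖X‖
  have hfcont1 : ∀ X, Continuous fun P => f P X := fun X => by fun_prop
  have hfcont2 : ∀ P, Continuous fun X => f P X := fun P => by fun_prop
  have hconv : ∀ X ∈ (W : Set (H →L[ℂ] K)), QuasiconvexOn ℝ C fun P => f P X := fun X _ => by
    refine ConvexOn.quasiconvexOn ⟨convex_closedConvexHull, fun P _ Q _ s t _ _ hst => ?_⟩
    have h1 : ∀ i, inner ℂ (A (b i)) (X ((s • P + t • Q) (b i))) =
        s * inner ℂ (A (b i)) (X (P (b i))) + t * inner ℂ (A (b i)) (X (Q (b i))) := fun i => by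
      simp [inner_smul_right_eq_smul]
    simp only [f, h1, Finset.sum_add_distrib, ← Finset.mul_sum]
    simp
    linear_combination (c * ‖X‖) * hst
  have hconc : ∀ P ∈ C, QuasiconcaveOn ℝ (W : Set (H →L[ℂ] K)) fun X => f P X := fun P _ => by
    refine ConcaveOn.quasiconcaveOn
      ⟨(W.restrictScalars ℝ).convex, fun X _ Y _ s t hs ht hst => ?_⟩
    have h1 : ∀ i, inner ℂ (A (b i)) ((s • X + t • Y) (P (b i))) =
        s * inner ℂ (A (b i)) (X (P (b i))) + t * inner ℂ (A (b i)) (Y (P (b i))) := fun i => by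
      simp [inner_smul_right_eq_smul]
    have h2 : ‖s • X + t • Y‖ ≤ s * ‖X‖ + t * ‖Y‖ := by
      simpa [norm_smul, abs_of_nonneg hs, abs_of_nonneg ht] using norm_add_le (s • X) (t • Y)
    simp only [f, h1, Finset.sum_add_distrib, ← Finset.mul_sum]
    simp
    linarith [mul_le_mul_of_nonneg_left h2 hc]
  have hCne : C.Nonempty := by
    obtain ⟨u, huE, hu1, -⟩ := h 0 W.zero_mem
    exact ⟨_, subset_closedConvexHull ⟨⟨u, huE⟩, by simpa using hu1, rfl⟩⟩
  by_contra! hcon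
  have hcov : ∀ P ∈ C, ∃ X ∈ W, 0 < f P X := fun P hP => by
    obtain ⟨X, hX, hlt⟩ := hcon P (hCD hP)
    exact ⟨X, hX, by simp only [f]; linarith⟩
  obtain ⟨s, hsW, hsfin, hscov⟩ := hCcpt.elim_finite_subcover_image
    (b := (W : Set (H →L[ℂ] K))) (c := fun X => {P | 0 < f P X})
    (fun X _ => isOpen_lt continuous_const (hfcont1 X))
    (fun P hP => by simpa using hcov P hP)
  obtain ⟨X, hX, hpos⟩ := Sion.exists_lt_iInf_of_lt_iInf_of_finite (f := f) (t := 0)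
    (Y := (W : Set (H →L[ℂ] K)))
    hCne hCcpt (fun X _ => (hfcont1 X).lowerSemicontinuous.lowerSemicontinuousOn _)
    hconv (W.restrictScalars ℝ).convex
    (fun P _ => (hfcont2 P).upperSemicontinuous.upperSemicontinuousOn _)
    hconc convex_closedConvexHull hsfin hsW
    (fun P hP => by simpa using hscov hP)
  obtain ⟨u, huE, hu1, hle⟩ := h X hX
  have := hpos _ (subset_closedConvexHull ⟨⟨u, huE⟩, by simpa using hu1, rfl⟩)
  simp only [f, sum_inner_rankOne_self E b A X ⟨u, huE⟩] at this
  linarith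

lemma norm_add_sq_ge_of_density (A X : H →L[ℂ] K) (P : H →L[ℂ] H) (hP : P.IsPositive)
    (hfin : FiniteDimensional ℂ (LinearMap.range (P : H →ₗ[ℂ] H))) (htr : finRankTrace P = 1)
    (hAP : ((adjoint A) ∘L A) ∘L P = (‖A‖ ^ 2 : ℝ) • P) :
    ‖A‖ ^ 2 + 2 * (finRankTrace (((adjoint A) ∘L X) ∘L P)).re ≤ ‖A + X‖ ^ 2 := by
  let R := LinearMap.range (P : H →ₗ[ℂ] H)
  let T : R →ₗ[ℂ] R := (P : H →ₗ[ℂ] H).restrict fun x _ => LinearMap.mem_range_self _ x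
  have hT : T.IsSymmetric := fun x y => hP.isSymmetric x y
  let u := hT.eigenvectorBasis rfl
  let l := hT.eigenvalues rfl
  have hu : ∀ i, P (u i) = (l i : ℂ) • (u i : H) := fun i =>
    congrArg Subtype.val (hT.apply_eigenvectorBasis rfl i)
  have hu1 : ∀ i, ‖(u i : H)‖ = 1 := fun i => u.orthonormal.1 i
  have hl : ∀ i, 0 ≤ l i := fun i => by
    have := hP.re_inner_nonneg_right (u i : H)
    rw [hu, inner_smul_right, inner_self_eq_norm_sq_to_K, hu1] at this
    simpa using this
  have hker : ∀ x ∈ Rᗮ, P x = 0 := fun x hx => by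
    rw [← inner_self_eq_zero (𝕜 := ℂ)]
    exact (hP.inner_left_eq_inner_right x (P x)).trans
      (Submodule.inner_left_of_mem_orthogonal (LinearMap.mem_range_self _ _) hx)
  have hsum : ∑ i, l i = 1 := by
    rw [finRankTrace_eq_sum_inner P hfin R hker u] at htr
    simp only [hu, inner_smul_right, inner_self_eq_norm_sq_to_K, hu1] at htr
    simp at htr
    exact_mod_cast htr
  have hrange : FiniteDimensional ℂ
      (LinearMap.range ((((adjoint A) ∘L X) ∘L P : H →L[ℂ] H) : H →ₗ[ℂ] H)) := by
    rw [ContinuousLinearMap.toLinearMap_comp, LinearMap.range_comp]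
    infer_instance
  rw [finRankTrace_eq_sum_inner _ hrange R (fun x hx => by simp [hker x hx]) u]
  have hval : ∀ i, inner ℂ (u i : H) ((((adjoint A) ∘L X) ∘L P) (u i)) =
      l i * inner ℂ (A (u i)) (X (u i)) := fun i => by
    simp [hu, adjoint_inner_right]
  have hAu : ∀ i, l i * ‖A (u i)‖ ^ 2 = l i * ‖A‖ ^ 2 := fun i => by
    have := congrArg (fun Q : H →L[ℂ] H => (inner ℂ (u i : H) (Q (u i)))) hAP
    simp only [comp_apply, smul_apply, hu, map_smul, inner_smul_right, adjoint_inner_right,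
      inner_self_eq_norm_sq_to_K, hu1, ← Complex.coe_smul] at this
    rw [mul_comm _ (‖A‖ ^ 2)]
    rw [RCLike.ofReal_one, one_pow, mul_one] at this
    refine Complex.ofReal_injective ?_
    push_cast at this ⊢
    exact this
  have hterm : ∀ i, l i * ‖A‖ ^ 2 + 2 * (l i * (inner ℂ (A (u i)) (X (u i))).re) ≤
      l i * ‖A + X‖ ^ 2 := fun i => by
    have h1 := norm_add_ofReal_smul_sq (A (u i)) (X (u i)) 1
    simp at h1
    have h2 : ‖A (u i) + X (u i)‖ ^ 2 ≤ ‖A + X‖ ^ 2 := by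
      gcongr
      exact (A + X).unit_le_opNorm _ (hu1 i).le
    rw [h1] at h2
    linarith [hAu i, mul_le_mul_of_nonneg_left h2 (hl i), mul_nonneg (hl i) (sq_nonneg ‖X (u i)‖)]
  have := Finset.sum_le_sum fun i (_ : i ∈ Finset.univ) => hterm i
  rw [Finset.sum_add_distrib, ← Finset.sum_mul, ← Finset.sum_mul, hsum, one_mul, one_mul,
    ← Finset.mul_sum] at this
  simp only [hval, Complex.re_sum, Complex.re_ofReal_mul]
  exact this

end

theorem epsilon_birkhoff_subspace_compact_iff
    {H K : Type*} [NormedAddCommGroup H] [InnerProductSpace ℂ H] [CompleteSpace H]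
    [NormedAddCommGroup K] [InnerProductSpace ℂ K] [CompleteSpace K]
    (A : H →L[ℂ] K) (hA : A ≠ 0) (hcpt : IsCompactOperator A)
    (W : Submodule ℂ (H →L[ℂ] K)) (ε : ℝ) (hε : ε ∈ Set.Ico (0 : ℝ) 1) :
    (∀ X ∈ W, ‖A + X‖ ^ 2 ≥ ‖A‖ ^ 2 - 2 * ε * ‖A‖ * ‖X‖) ↔
      ∃ P : H →L[ℂ] H, P.IsPositive ∧
        FiniteDimensional ℂ (LinearMap.range (P : H →ₗ[ℂ] H)) ∧
        finRankTrace P = 1 ∧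
        ((adjoint A) ∘L A) ∘L P = (‖A‖ ^ 2 : ℝ) • P ∧
        ∀ X ∈ W, ‖finRankTrace (((adjoint A) ∘L X) ∘L P)‖ ≤ ε * ‖A‖ * ‖X‖ := by
  constructor
  · intro h
    have hm : ((‖A‖ ^ 2 : ℝ) : ℂ) ≠ 0 := by
      exact_mod_cast (pow_pos (norm_pos_iff.2 hA) 2).ne'
    let E := Module.End.eigenspace ((adjoint A ∘L A : H →L[ℂ] H) : H →ₗ[ℂ] H)
      ((‖A‖ ^ 2 : ℝ) : ℂ)
    have hEfin : FiniteDimensional ℂ E :=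
      ContinuousLinearMap.finite_dimensional_eigenspace (T := adjoint A ∘L A)
        (hcpt.clm_comp (adjoint A)) _ hm
    have hE : ∀ x, x ∈ E ↔ adjoint A (A x) = ((‖A‖ ^ 2 : ℝ) : ℂ) • x := fun x =>
      Module.End.mem_eigenspace_iff
    let b := stdOrthonormalBasis ℂ E
    obtain ⟨P, ⟨hP, hPE, hPtr⟩, hPW⟩ := exists_density_forall_nonneg A W
      (mul_nonneg hε.1 (norm_nonneg A)) E b fun X hX => by
        obtain ⟨u, hu1, huE, hu⟩ := hcpt.exists_norm_attaining_le_re_inner hA X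
          (-(ε * ‖A‖ * ‖X‖)) fun t ht => by
            have := h _ (W.smul_mem (t : ℂ) hX)
            rw [norm_smul, Complex.norm_real, Real.norm_of_nonneg ht.le] at this
            linarith
        exact ⟨u, (hE u).2 huE, hu1, hu⟩
    have hker : ∀ x ∈ Eᗮ, P x = 0 := fun x hx => by
      rw [← inner_self_eq_zero (𝕜 := ℂ)]
      exact (hP.inner_left_eq_inner_right x (P x)).trans
        (Submodule.inner_left_of_mem_orthogonal (hPE _) hx)
    have hfin : FiniteDimensional ℂ (LinearMap.range (P : H →ₗ[ℂ] H)) :=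
      Submodule.finiteDimensional_of_le (S₂ := E) (by rintro _ ⟨x, rfl⟩; exact hPE x)
    have htrX : ∀ X : H →L[ℂ] K, finRankTrace (((adjoint A) ∘L X) ∘L P) =
        ∑ i, inner ℂ (A (b i)) (X (P (b i))) := fun X => by
      rw [finRankTrace_eq_sum_inner _ _ E (fun x hx => by simp [hker x hx]) b]
      · simp [adjoint_inner_right]
      · rw [ContinuousLinearMap.toLinearMap_comp, LinearMap.range_comp]
        infer_instance
    refine ⟨P, hP, hfin, (finRankTrace_eq_sum_inner P hfin E hker b).trans hPtr, ?_, ?_⟩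
    · ext x
      exact (hE _).1 (hPE x)
    · intro X hX
      rw [htrX]
      set z := ∑ i, inner ℂ (A (b i)) (X (P (b i))) with hz
      obtain ⟨a, ha1, ha⟩ : ∃ a : ℂ, ‖a‖ = 1 ∧ a * z = -(‖z‖ : ℂ) := by
        rcases eq_or_ne z 0 with h0 | h0
        · exact ⟨1, by simp, by simp [h0]⟩
        · have hz0 : (‖z‖ : ℂ) ≠ 0 := by simpa using h0
          refine ⟨-(‖z‖ / z), by simp [h0], ?_⟩
          field_simp
      have h1 := hPW _ (W.smul_mem a hX)
      have h2 : ∑ i, inner ℂ (A (b i)) ((a • X) (P (b i))) = a * z := by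
        simp [hz, Finset.mul_sum]
      rw [h2, ha, norm_smul, ha1] at h1
      simp at h1
      linarith
  · rintro ⟨P, hP, hfin, htr, hAP, hW⟩ X hX
    have h1 := norm_add_sq_ge_of_density A X P hP hfin htr hAP
    have h2 := (Complex.abs_re_le_norm _).trans (hW X hX)
    have h3 := (abs_le.1 h2).1
    linarith
end

section
/- Let x be a nonzero element of a normed space X. Then the subdifferential of the function y ↦ ‖y‖² at x equals 2‖x‖ · ∂‖x‖, where ∂‖x‖ = { f ∈ X* : ‖f‖ = 1, Re f(x) = ‖x‖ }. -/
open Filter Set Pointwise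

theorem opNorm_le_of_re_le
    {𝕜 X : Type*} [RCLike 𝕜] [NormedAddCommGroup X] [NormedSpace 𝕜 X]
    {f : X →L[𝕜] 𝕜} {C : ℝ} (hC : 0 ≤ C) (h : ∀ z : X, RCLike.re (f z) ≤ C * ‖z‖) :
    ‖f‖ ≤ C := by
  refine f.opNorm_le_bound hC fun z ↦ ?_
  obtain ⟨c, hc, hcz⟩ := RCLike.exists_norm_eq_mul_self (f z)
  have key := h (c • z)
  rwa [map_smul, smul_eq_mul, ← hcz, RCLike.ofReal_re, norm_smul, hc, one_mul] at key

theorem re_apply_self_of_mem_subdifferential_norm_sq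
    {𝕜 X : Type*} [RCLike 𝕜] [NormedAddCommGroup X] [NormedSpace 𝕜 X]
    {x : X} (hx : x ≠ 0) {f : X →L[𝕜] 𝕜}
    (hf : ∀ y : X, RCLike.re (f (y - x)) ≤ ‖y‖ ^ 2 - ‖x‖ ^ 2) :
    RCLike.re (f x) = 2 * ‖x‖ ^ 2 := by
  have hb : 0 < ‖x‖ ^ 2 := by positivity
  have hray (t : ℝ) : t * (RCLike.re (f x) - 2 * ‖x‖ ^ 2) ≤ t ^ 2 * ‖x‖ ^ 2 := by
    have h := hf (((1 + t : ℝ) : 𝕜) • x)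
    have hsub : ((1 + t : ℝ) : 𝕜) • x - x = (t : 𝕜) • x := by
      push_cast
      module
    rw [hsub, map_smul, smul_eq_mul, RCLike.re_ofReal_mul, norm_smul, RCLike.norm_ofReal,
      mul_pow, sq_abs] at h
    linarith
  have h := hray ((RCLike.re (f x) - 2 * ‖x‖ ^ 2) / (2 * ‖x‖ ^ 2))
  generalize hc : RCLike.re (f x) - 2 * ‖x‖ ^ 2 = c at h
  have hsq : c ^ 2 ≤ 0 := by
    field_simp at h
    nlinarith
  have : c = 0 := by nlinarith
  linarith

theorem subdifferential_norm_sq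
    {𝕜 X : Type*} [RCLike 𝕜] [NormedAddCommGroup X] [NormedSpace 𝕜 X]
    (x : X) (hx : x ≠ 0) :
    {f : X →L[𝕜] 𝕜 | ∀ y : X, RCLike.re (f (y - x)) ≤ ‖y‖ ^ 2 - ‖x‖ ^ 2} =
      ((2 * ‖x‖ : ℝ) : 𝕜) • {f : X →L[𝕜] 𝕜 | ‖f‖ = 1 ∧ RCLike.re (f x) = ‖x‖} := by
  have hpos : 0 < ‖x‖ := norm_pos_iff.mpr hx
  ext f
  constructor
  · intro hf
    have hfx := re_apply_self_of_mem_subdifferential_norm_sq hx hf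
    have hre (z : X) : RCLike.re (f z) ≤ 2 * ‖x‖ * ‖z‖ := by
      rcases eq_or_ne z 0 with rfl | hz
      · simp
      have hzpos : 0 < ‖z‖ := norm_pos_iff.mpr hz
      have h := hf (((‖x‖ / ‖z‖ : ℝ) : 𝕜) • z)
      rw [map_sub, map_sub, hfx, map_smul, smul_eq_mul, RCLike.re_ofReal_mul, norm_smul,
        RCLike.norm_ofReal, abs_of_pos (by positivity), div_mul_cancel₀ _ hzpos.ne', sub_self,
        sub_nonpos, div_mul_eq_mul_div, div_le_iff₀ hzpos] at h
      refine le_of_mul_le_mul_left ?_ hpos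
      linarith
    have hnorm : ‖f‖ = 2 * ‖x‖ := by
      refine le_antisymm (opNorm_le_of_re_le (by positivity) hre) ?_
      have h := (RCLike.re_le_norm (f x)).trans (f.le_opNorm x)
      refine le_of_mul_le_mul_right ?_ hpos
      linarith
    have hne : ((2 * ‖x‖ : ℝ) : 𝕜) ≠ 0 := RCLike.ofReal_ne_zero.mpr (by positivity)
    rw [Set.mem_smul_set_iff_inv_smul_mem₀ hne, ← RCLike.ofReal_inv]
    constructor
    · rw [norm_smul, RCLike.norm_ofReal, abs_of_pos (by positivity), hnorm]
      field_simp
    · rw [smul_apply, smul_eq_mul, RCLike.re_ofReal_mul, hfx]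
      field_simp
  · rintro ⟨g, ⟨hg, hgx⟩, rfl⟩ y
    have h := (RCLike.re_le_norm (g y)).trans (g.le_opNorm y)
    rw [hg, one_mul] at h
    simp only [smul_apply, smul_eq_mul, RCLike.re_ofReal_mul, map_sub, hgx]
    nlinarith [sq_nonneg (‖y‖ - ‖x‖), mul_le_mul_of_nonneg_left h hpos.le]
end
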